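/- Kernel characterization of causality: A transport plan γ ∈ Π(μ,ν) is causal if and only if, when γ is decomposed by successive disintegration as γ(dx₁,…,dx_N,dy₁,…,dy_N) = γ̄(dx₁,dy₁) γ^{x₁,y₁}(dx₂,dy₂) ⋯ γ^{x₁,…,x_{N−1},y₁,…,y_{N−1}}(dx_N,dy_N), one has: (i) γ̄ ∈ Π(μ₁,ν₁) where μ₁,ν₁ are the first marginals of μ,ν; (ii) for every t < N and γ-almost all (x₁,…,x_t,y₁,…,y_t), the first marginal of γ^{x₁,…,x_t,y₁,…,y_t}(dx_{t+1},dy_{t+1}) equals μ^{x₁,…,x_t}(dx_{t+1}); and (iii) for ν-almost all (y₁,…,y_t), the disintegration γ^{y₁,…,y_t}(dy_{t+1}) of the second-coordinate process equals ν^{y₁,…,y_t}(dy_{t+1}). -/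

import Mathlib

open MeasureTheory ProbabilityTheory Set Filter
open scoped ENNReal NNReal BoundedContinuousFunction

noncomputable section

namespace CausalTransport

/-- The path space of a real-valued process in `N` time steps. -/
abbrev Path (N : ℕ) := Fin N → ℝ

/-- Truncation of a path to its first `t` coordinates. -/
def proj (N t : ℕ) (x : Path N) : Fin t → ℝ :=
  fun i => if h : (i : ℕ) < N then x ⟨i, h⟩ else 0

/-- The coordinate with (0-based) index `t`, with junk value `0` if `t ≥ N`. -/
def coord (N t : ℕ) (x : Path N) : ℝ := if h : t < N then x ⟨t, h⟩ else 0

/-- The coordinates of a path after time `t`. -/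
def tailProj (N t : ℕ) (x : Path N) : Fin (N - t) → ℝ := fun i => coord N (t + i) x

/-- Extension of a history of length `t` by one further value. -/
def snocFun (t : ℕ) (xs : Fin t → ℝ) (r : ℝ) : Fin (t + 1) → ℝ :=
  fun i => if h : (i : ℕ) < t then xs ⟨i, h⟩ else r

/-- Extension of a history of length `t` to a full path (by `0`). -/
def pad (N t : ℕ) (xs : Fin t → ℝ) : Path N :=
  fun i => if h : (i : ℕ) < t then xs ⟨i, h⟩ else 0

/-- Glue the first `t` coordinates of `x` with the later coordinates `z`. -/
def glue (N t : ℕ) (x : Path N) (z : Fin (N - t) → ℝ) : Path N :=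
  fun i => if (i : ℕ) < t then x i else
    if h : (i : ℕ) - t < N - t then z ⟨(i : ℕ) - t, h⟩ else 0

/-- Truncation of a pair of paths to the first `t` coordinates of each. -/
def pairProj (N t : ℕ) (p : Path N × Path N) : (Fin t → ℝ) × (Fin t → ℝ) :=
  (proj N t p.1, proj N t p.2)

/-- The σ-algebra on path space generated by the first `t` coordinates. -/
def filt (N t : ℕ) : MeasurableSpace (Path N) :=
  MeasurableSpace.comap (proj N t) inferInstance

/-- `γ` is a transport plan (coupling) between `μ` and `ν`. -/
def IsCoupling {α β : Type*} [MeasurableSpace α] [MeasurableSpace β]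
    (μ : Measure α) (ν : Measure β) (γ : Measure (α × β)) : Prop :=
  γ.map Prod.fst = μ ∧ γ.map Prod.snd = ν

/-- `γ` is a causal transport plan between `μ` and `ν`: it is a coupling and, for any
disintegration `K` of `γ` over its first coordinate and any `t ∈ {1,…,N}`, the map
`x ↦ K x B` is measurable for the σ-algebra of the first `t` coordinates (up to `μ`-null
sets) whenever `B` is measurable for the first `t` coordinates. -/
def IsCausal (N : ℕ) (μ ν : Measure (Path N)) (γ : Measure (Path N × Path N)) : Prop :=
  IsCoupling μ ν γ ∧
  ∀ K : Kernel (Path N) (Path N), IsSFiniteKernel K → μ ⊗ₘ K = γ →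
    ∀ t : ℕ, 1 ≤ t → t ≤ N → ∀ B : Set (Path N), MeasurableSet[filt N t] B →
      ∃ g : Path N → ℝ≥0∞, Measurable[filt N t] g ∧ (fun x => K x B) =ᵐ[μ] g

/-- `γ` is a bicausal transport plan between `μ` and `ν`. -/
def IsBicausal (N : ℕ) (μ ν : Measure (Path N)) (γ : Measure (Path N × Path N)) : Prop :=
  IsCausal N μ ν γ ∧ IsCausal N ν μ (γ.map Prod.swap)

/-- Regular conditional distribution, under `μ`, of the coordinate of index `t`
given the first `t` coordinates. -/
def nextK (N : ℕ) (μ : Measure (Path N)) [IsFiniteMeasure μ] (t : ℕ) :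
    Kernel (Fin t → ℝ) ℝ :=
  (μ.map (fun x => (proj N t x, coord N t x))).condKernel

/-- Regular conditional distribution, under `μ`, of all the coordinates after time `t`
given the first `t` coordinates. -/
def tailK (N : ℕ) (μ : Measure (Path N)) [IsFiniteMeasure μ] (t : ℕ) :
    Kernel (Fin t → ℝ) (Fin (N - t) → ℝ) :=
  (μ.map (fun x => (proj N t x, tailProj N t x))).condKernel

/-- Regular conditional distribution, under `γ`, of the pair of coordinates of index `t`
given the first `t` coordinates of both paths. -/
def stepK (N : ℕ) (γ : Measure (Path N × Path N)) [IsFiniteMeasure γ] (t : ℕ) :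
    Kernel ((Fin t → ℝ) × (Fin t → ℝ)) (ℝ × ℝ) :=
  (γ.map (fun p => (pairProj N t p, (coord N t p.1, coord N t p.2)))).condKernel

/-- Regular conditional distribution, under `μ`, of the coordinate of index `t` given the
single coordinate of index `t-1` (one-step Markov transition kernel). -/
def mstep (N : ℕ) (μ : Measure (Path N)) [IsFiniteMeasure μ] (t : ℕ) : Kernel ℝ ℝ :=
  (μ.map (fun x => (coord N (t - 1) x, coord N t x))).condKernel

/-- `μ` is a Markov measure. -/
def IsMarkovMeasure (N : ℕ) (μ : Measure (Path N)) [IsFiniteMeasure μ] : Prop :=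
  ∀ (t : ℕ) (ht : 1 ≤ t) (_ : t < N),
    ∀ᵐ xs ∂(μ.map (proj N t)), nextK N μ t xs = mstep N μ t (xs ⟨t - 1, by omega⟩)

/-- A causal plan is causal quasi-Markov if (every version of) the conditional law of
`(x_{t+1}, y_{t+1})` given `(x_1,…,x_t,y_1,…,y_t)` depends a.s. only on `(x_t, y_1,…,y_t)`. -/
def IsQuasiMarkov (N : ℕ) (γ : Measure (Path N × Path N)) : Prop :=
  ∀ (t : ℕ) (ht : 1 ≤ t) (_ : t < N),
    ∀ S : Kernel ((Fin t → ℝ) × (Fin t → ℝ)) (ℝ × ℝ), IsSFiniteKernel S →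
      (γ.map (pairProj N t)) ⊗ₘ S
          = γ.map (fun p => (pairProj N t p, (coord N t p.1, coord N t p.2))) →
      ∃ κ : Kernel (ℝ × (Fin t → ℝ)) (ℝ × ℝ),
        ∀ᵐ z ∂(γ.map (pairProj N t)), S z = κ (z.1 ⟨t - 1, by omega⟩, z.2)

/-- Topological support of a measure. -/
def msupport {α : Type*} [TopologicalSpace α] [MeasurableSpace α] (μ : Measure α) : Set α :=
  {x | ∀ U : Set α, IsOpen U → x ∈ U → μ U ≠ 0}

/-- `K` is a version of the disintegration of `μ` at time `t` which is weakly continuous on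
the support of the first `t` coordinates of `μ`. -/
def WeaklyContinuousDisintegration (N t : ℕ) (μ : Measure (Path N))
    (K : Kernel (Fin t → ℝ) (Fin (N - t) → ℝ)) : Prop :=
  IsMarkovKernel K ∧
  (μ.map (proj N t)) ⊗ₘ K = μ.map (fun x => (proj N t x, tailProj N t x)) ∧
  ∀ f : (Fin (N - t) → ℝ) →ᵇ ℝ,
    ContinuousOn (fun xs => ∫ z, f z ∂(K xs)) (msupport (μ.map (proj N t)))

/-- `μ` is successively weakly continuous. -/
def SuccWeakCont (N : ℕ) (μ : Measure (Path N)) : Prop :=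
  ∀ t : ℕ, t < N → ∃ K : Kernel (Fin t → ℝ) (Fin (N - t) → ℝ),
    WeaklyContinuousDisintegration N t μ K

/-- The cumulative distribution function of a measure on `ℝ`. -/
def cdf1 (η : Measure ℝ) (z : ℝ) : ℝ := (η (Iic z)).toReal

/-- The left-continuous generalized inverse (quantile function) of the c.d.f. of `η`. -/
def qinv (η : Measure ℝ) (u : ℝ) : ℝ := sInf {y : ℝ | u ≤ cdf1 η y}

/-- Partial Knothe–Rosenblatt path built from the "uniform" inputs `u`. -/
def krPartial (N : ℕ) (μ : Measure (Path N)) [IsFiniteMeasure μ] (u : ℕ → ℝ) :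
    (t : ℕ) → Fin t → ℝ
  | 0 => Fin.elim0
  | t + 1 => snocFun t (krPartial N μ u t)
      (qinv (nextK N μ t (krPartial N μ u t)) (u t))

/-- The Knothe–Rosenblatt (quantile transform) path built from uniform inputs. -/
def krPath (N : ℕ) (μ : Measure (Path N)) [IsFiniteMeasure μ] (u : Path N) : Path N :=
  krPartial N μ (fun n => if h : n < N then u ⟨n, h⟩ else 0) N

/-- The uniform distribution on `[0,1]`. -/
def unif01 : Measure ℝ := volume.restrict (Icc (0 : ℝ) 1)

instance : IsProbabilityMeasure unif01 := by
  constructor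
  simp [unif01, Real.volume_Icc]

/-- N independent uniforms on `[0,1]`. -/
def uniformCube (N : ℕ) : Measure (Path N) := Measure.pi fun _ => unif01

instance (N : ℕ) : IsProbabilityMeasure (uniformCube N) :=
  inferInstanceAs (IsProbabilityMeasure (Measure.pi fun _ : Fin N => unif01))

/-- The (increasing) Knothe–Rosenblatt rearrangement of `(μ, ν)`: the joint law of
`(X*, Y*)` where both paths are built from the same independent uniforms. -/
def krCoupling (N : ℕ) (μ ν : Measure (Path N)) [IsFiniteMeasure μ] [IsFiniteMeasure ν] :
    Measure (Path N × Path N) :=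
  (uniformCube N).map (fun u => (krPath N μ u, krPath N ν u))

/-- Partial Knothe–Rosenblatt Monge map. -/
def krMapPartial (N : ℕ) (μ ν : Measure (Path N)) [IsFiniteMeasure μ] [IsFiniteMeasure ν]
    (x : Path N) : (t : ℕ) → Fin t → ℝ
  | 0 => Fin.elim0
  | t + 1 => snocFun t (krMapPartial N μ ν x t)
      (qinv (nextK N ν t (krMapPartial N μ ν x t))
        (cdf1 (nextK N μ t (proj N t x)) (coord N t x)))

/-- The Knothe–Rosenblatt Monge map from `μ` to `ν`. -/
def krMap (N : ℕ) (μ ν : Measure (Path N)) [IsFiniteMeasure μ] [IsFiniteMeasure ν]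
    (x : Path N) : Path N :=
  krMapPartial N μ ν x N

open Classical in
/-- Relative entropy `Ent(ν|μ)`, via the nonnegative integrand `f log f - f + 1`,
`f = dν/dμ`; equals `∫ log (dν/dμ) dν` for probability measures. -/
def relEnt {α : Type*} [MeasurableSpace α] (ν μ : Measure α) : ℝ≥0∞ :=
  if ν ≪ μ then
    ∫⁻ x, ENNReal.ofReal
      ((ν.rnDeriv μ x).toReal * Real.log (ν.rnDeriv μ x).toReal
        - (ν.rnDeriv μ x).toReal + 1) ∂μ
  else ∞

/-- Universally measurable `ℝ≥0∞`-valued function. -/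
def UnivMeasurable {α : Type*} [MeasurableSpace α] (f : α → ℝ≥0∞) : Prop :=
  ∀ P : Measure α, IsFiniteMeasure P → AEMeasurable f P

/-! ### Helper lemmas -/

lemma measurable_proj (N t : ℕ) : Measurable (proj N t) := by
  refine measurable_pi_lambda _ fun i => ?_
  unfold proj
  by_cases h : (i : ℕ) < N
  · simp only [h, dite_true]; exact measurable_pi_apply _
  · simp only [h, dite_false]; exact measurable_const

lemma measurable_coord (N t : ℕ) : Measurable (coord N t) := by
  unfold coord
  by_cases h : t < N
  · simp only [h, dite_true]; exact measurable_pi_apply _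
  · simp only [h, dite_false]; exact measurable_const

lemma measurable_pairProj (N t : ℕ) : Measurable (pairProj N t) :=
  ((measurable_proj N t).comp measurable_fst).prodMk ((measurable_proj N t).comp measurable_snd)

lemma measurable_snocFun (t : ℕ) :
    Measurable (fun p : (Fin t → ℝ) × ℝ => snocFun t p.1 p.2) := by
  refine measurable_pi_lambda _ fun i => ?_
  unfold snocFun
  by_cases h : (i : ℕ) < t
  · simp only [h, dite_true]; exact (measurable_pi_apply _).comp measurable_fst
  · simp only [h, dite_false]; exact measurable_snd

lemma proj_succ (N s : ℕ) (x : Path N) :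
    proj N (s + 1) x = snocFun s (proj N s x) (coord N s x) := by
  funext i
  by_cases h : (i : ℕ) < s
  · simp [proj, snocFun, h]
  · have : (i : ℕ) = s := by omega
    simp [proj, snocFun, coord, this]

/-- Restriction of a history of length `s` to length `t ≤ s`. -/
def restr {t s : ℕ} (h : t ≤ s) (v : Fin s → ℝ) : Fin t → ℝ := fun i => v (Fin.castLE h i)

lemma measurable_restr {t s : ℕ} (h : t ≤ s) : Measurable (restr h) :=
  measurable_pi_lambda _ fun _ => measurable_pi_apply _

lemma restr_proj {N t s : ℕ} (h : t ≤ s) (x : Path N) :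
    restr h (proj N s x) = proj N t x := by
  funext i; simp [restr, proj]

lemma proj_self (N : ℕ) (x : Path N) : proj N N x = x := by
  funext i; simp [proj]

lemma lintegral_condKernel_map {Ω α β : Type*} [MeasurableSpace Ω] [MeasurableSpace α]
    [MeasurableSpace β] [StandardBorelSpace β] [Nonempty β]
    (m : Measure Ω) [IsFiniteMeasure m] {X : Ω → α} {Y : Ω → β}
    (hX : Measurable X) (hY : Measurable Y) {ψ : α × β → ℝ≥0∞} (hψ : Measurable ψ) :
    ∫⁻ ω, ψ (X ω, Y ω) ∂m
      = ∫⁻ ω, ∫⁻ r, ψ (X ω, r) ∂((m.map (fun ω => (X ω, Y ω))).condKernel (X ω)) ∂m := by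
  have hfst : (m.map (fun ω => (X ω, Y ω))).fst = m.map X := Measure.fst_map_prodMk hY
  have h1 : ∫⁻ ω, ψ (X ω, Y ω) ∂m = ∫⁻ p, ψ p ∂(m.map (fun ω => (X ω, Y ω))) :=
    (lintegral_map hψ (hX.prodMk hY)).symm
  rw [h1]
  conv_lhs => rw [← (m.map (fun ω => (X ω, Y ω))).disintegrate
    (m.map (fun ω => (X ω, Y ω))).condKernel]
  rw [Measure.lintegral_compProd hψ, hfst, lintegral_map _ hX]
  exact hψ.lintegral_kernel_prod_right'

lemma ae_eq_condKernel_map {Ω α β : Type*} [MeasurableSpace Ω] [MeasurableSpace α]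
    [MeasurableSpace β] [StandardBorelSpace β] [Nonempty β]
    (m : Measure Ω) [IsFiniteMeasure m] {X : Ω → α} {Y : Ω → β}
    (hY : Measurable Y) (κ : Kernel α β) [IsFiniteKernel κ]
    (h : m.map (fun ω => (X ω, Y ω)) = (m.map X) ⊗ₘ κ) :
    ∀ᵐ z ∂(m.map X), κ z = (m.map (fun ω => (X ω, Y ω))).condKernel z := by
  have hfst : (m.map (fun ω => (X ω, Y ω))).fst = m.map X := Measure.fst_map_prodMk hY
  have := eq_condKernel_of_measure_eq_compProd (ρ := m.map (fun ω => (X ω, Y ω))) κ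
    (by rw [hfst]; exact h)
  rwa [hfst] at this

instance (N : ℕ) (μ : Measure (Path N)) [IsFiniteMeasure μ] (t : ℕ) :
    IsMarkovKernel (nextK N μ t) := by unfold nextK; infer_instance

instance (N : ℕ) (γ : Measure (Path N × Path N)) [IsFiniteMeasure γ] (t : ℕ) :
    IsMarkovKernel (stepK N γ t) := by unfold stepK; infer_instance

lemma lintegral_nextK (N : ℕ) (μ : Measure (Path N)) [IsFiniteMeasure μ] (t : ℕ)
    {ψ : (Fin t → ℝ) × ℝ → ℝ≥0∞} (hψ : Measurable ψ) :
    ∫⁻ x, ψ (proj N t x, coord N t x) ∂μ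
      = ∫⁻ x, ∫⁻ r, ψ (proj N t x, r) ∂(nextK N μ t (proj N t x)) ∂μ :=
  lintegral_condKernel_map μ (measurable_proj N t) (measurable_coord N t) hψ

lemma lintegral_stepK (N : ℕ) (γ : Measure (Path N × Path N)) [IsFiniteMeasure γ] (t : ℕ)
    {ψ : ((Fin t → ℝ) × (Fin t → ℝ)) × ℝ → ℝ≥0∞} (hψ : Measurable ψ) :
    ∫⁻ p, ψ (pairProj N t p, coord N t p.1) ∂γ
      = ∫⁻ p, ∫⁻ r, ψ (pairProj N t p, r) ∂((stepK N γ t (pairProj N t p)).map Prod.fst) ∂γ := by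
  have h := lintegral_condKernel_map γ (measurable_pairProj N t)
    (((measurable_coord N t).comp measurable_fst).prodMk
      ((measurable_coord N t).comp measurable_snd))
    (ψ := fun q => ψ (q.1, q.2.1)) (by fun_prop)
  refine h.trans (lintegral_congr fun p => ?_)
  rw [lintegral_map (by fun_prop) measurable_fst]
  rfl

/-- Integrating over `y ∈ B` through a disintegration. -/
lemma lintegral_disint {α β : Type*} [MeasurableSpace α] [MeasurableSpace β]
    (μ : Measure α) [SFinite μ] (K : Kernel α β) [IsSFiniteKernel K]
    {B : Set β} (hB : MeasurableSet B) {F : α → ℝ≥0∞} (hF : Measurable F) :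
    ∫⁻ p, F p.1 * B.indicator 1 p.2 ∂(μ ⊗ₘ K) = ∫⁻ x, F x * K x B ∂μ := by
  have hm : Measurable (B.indicator (1 : β → ℝ≥0∞)) := measurable_one.indicator hB
  rw [Measure.lintegral_compProd (by fun_prop)]
  refine lintegral_congr fun x => ?_
  simp only
  rw [lintegral_const_mul _ hm, lintegral_indicator_one hB]

lemma causal_step (N : ℕ) (μ ν : Measure (Path N)) [IsProbabilityMeasure μ]
    (γ : Measure (Path N × Path N)) [IsProbabilityMeasure γ]
    (hc : IsCausal N μ ν γ) (t : ℕ) (ht : 1 ≤ t) (htN : t < N) :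
    ∀ᵐ z ∂(γ.map (pairProj N t)), (stepK N γ t z).map Prod.fst = nextK N μ t z.1 := by
  obtain ⟨⟨hμ, -⟩, hc⟩ := hc
  have hK : μ ⊗ₘ γ.condKernel = γ := by
    conv_rhs => rw [← γ.disintegrate γ.condKernel]
    rw [← hμ]; rfl
  have hY : Measurable (fun p : Path N × Path N => coord N t p.1) :=
    (measurable_coord N t).comp measurable_fst
  have hP := measurable_pairProj N t
  have h1 := ae_eq_condKernel_map γ (X := pairProj N t) (Y := fun p => coord N t p.1) hY
    ((stepK N γ t).map Prod.fst) (by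
      ext s hs
      have hψ : Measurable (s.indicator (1 : ((Fin t → ℝ) × (Fin t → ℝ)) × ℝ → ℝ≥0∞)) :=
        measurable_one.indicator hs
      rw [← lintegral_indicator_one hs, ← lintegral_indicator_one hs,
        lintegral_map hψ (hP.prodMk hY), Measure.lintegral_compProd hψ,
        lintegral_map hψ.lintegral_kernel_prod_right' hP, lintegral_stepK N γ t hψ]
      refine lintegral_congr fun p => ?_
      rw [Kernel.map_apply _ measurable_fst])
  have h2 := ae_eq_condKernel_map γ (X := pairProj N t) (Y := fun p => coord N t p.1) hY
    ((nextK N μ t).comap Prod.fst measurable_fst) (by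
      rw [Measure.ext_prod₃_iff']
      intro A B C hA hB hC
      have hBm : MeasurableSet (proj N t ⁻¹' B) := measurable_proj N t hB
      obtain ⟨g, hg, hgK⟩ := hc γ.condKernel inferInstance hK t ht htN.le (proj N t ⁻¹' B)
        ⟨B, hB, rfl⟩
      obtain ⟨g', hg', rfl⟩ := hg.exists_eq_measurable_comp
      have hAi : Measurable (A.indicator (1 : (Fin t → ℝ) → ℝ≥0∞)) := measurable_one.indicator hA
      have hCi : Measurable (C.indicator (1 : ℝ → ℝ≥0∞)) := measurable_one.indicator hC
      have hBi : Measurable (B.indicator (1 : (Fin t → ℝ) → ℝ≥0∞)) := measurable_one.indicator hB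
      have hpr := measurable_proj N t
      have hco := measurable_coord N t
      have hnk : Measurable fun z => nextK N μ t z C := Kernel.measurable_coe _ hC
      have hS : MeasurableSet ((A ×ˢ B) ×ˢ C) := (hA.prod hB).prod hC
      have hL : γ.map (fun p => (pairProj N t p, coord N t p.1)) ((A ×ˢ B) ×ˢ C)
          = ∫⁻ p, (A.indicator 1 (proj N t p.1) * C.indicator 1 (coord N t p.1))
              * (proj N t ⁻¹' B).indicator 1 p.2 ∂γ := by
        rw [← lintegral_indicator_one hS, lintegral_map (measurable_one.indicator hS)
          (hP.prodMk hY)]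
        refine lintegral_congr fun p => ?_
        by_cases a : proj N t p.1 ∈ A <;> by_cases b : proj N t p.2 ∈ B <;>
          by_cases c : coord N t p.1 ∈ C <;> simp [pairProj, a, b, c, Set.indicator]
      have hR : ((γ.map (pairProj N t)) ⊗ₘ ((nextK N μ t).comap Prod.fst measurable_fst))
            ((A ×ˢ B) ×ˢ C)
          = ∫⁻ p, (A.indicator 1 (proj N t p.1) * nextK N μ t (proj N t p.1) C)
              * (proj N t ⁻¹' B).indicator 1 p.2 ∂γ := by
        rw [Measure.compProd_apply_prod (hA.prod hB) hC, ← lintegral_indicator (hA.prod hB),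
          lintegral_map _ hP]
        · refine lintegral_congr fun p => ?_
          by_cases a : proj N t p.1 ∈ A <;> by_cases b : proj N t p.2 ∈ B <;>
            simp [pairProj, a, b, Set.indicator]
        · exact (Kernel.measurable_coe _ hC).indicator (hA.prod hB)
      rw [hL, hR]
      have e1 := lintegral_disint μ γ.condKernel hBm
        (F := fun x => A.indicator 1 (proj N t x) * C.indicator 1 (coord N t x)) (by fun_prop)
      have e2 := lintegral_disint μ γ.condKernel hBm
        (F := fun x => A.indicator 1 (proj N t x) * nextK N μ t (proj N t x) C)
        ((hAi.comp hpr).mul (hnk.comp hpr))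
      rw [hK] at e1 e2
      rw [e1, e2]
      have f1 := lintegral_nextK N μ t
        (ψ := fun q => (A.indicator 1 q.1 * g' q.1) * C.indicator 1 q.2) (by fun_prop)
      calc _ = ∫⁻ x, (A.indicator 1 (proj N t x) * g' (proj N t x))
              * C.indicator 1 (coord N t x) ∂μ := by
            refine lintegral_congr_ae ?_
            filter_upwards [hgK] with x hx
            rw [hx]; simp only [Function.comp]; ring
        _ = _ := f1
        _ = _ := by
            refine lintegral_congr_ae ?_
            filter_upwards [hgK] with x hx
            rw [hx, lintegral_const_mul _ hCi, lintegral_indicator_one hC]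
            simp only [Function.comp]; ring)
  filter_upwards [h1, h2] with z hz1 hz2
  rw [Kernel.map_apply _ measurable_fst] at hz1
  rw [hz1, ← hz2, Kernel.comap_apply]

lemma step_causal (N : ℕ) (μ ν : Measure (Path N)) [IsProbabilityMeasure μ]
    (γ : Measure (Path N × Path N)) [IsProbabilityMeasure γ]
    (hγ : IsCoupling μ ν γ)
    (hs : ∀ t : ℕ, 1 ≤ t → t < N →
      ∀ᵐ z ∂(γ.map (pairProj N t)), (stepK N γ t z).map Prod.fst = nextK N μ t z.1) :
    IsCausal N μ ν γ := by
  refine ⟨hγ, ?_⟩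
  intro K hKs hK t ht htN B hB
  obtain ⟨B', hB', rfl⟩ := hB
  obtain ⟨hμ, -⟩ := hγ
  have hBm : MeasurableSet (proj N t ⁻¹' B') := measurable_proj N t hB'
  have hBp : MeasurableSet (Prod.snd ⁻¹' (proj N t ⁻¹' B') : Set (Path N × Path N)) :=
    measurable_snd hBm
  have hBi : Measurable (B'.indicator (1 : (Fin t → ℝ) → ℝ≥0∞)) := measurable_one.indicator hB'
  have hpf : Measurable (fun p : Path N × Path N => proj N t p.1) :=
    (measurable_proj N t).comp measurable_fst
  set ρ : Measure (Fin t → ℝ) :=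
    (γ.restrict (Prod.snd ⁻¹' (proj N t ⁻¹' B'))).map (fun p => proj N t p.1) with hρ
  have hμt : μ.map (proj N t) = γ.map (fun p => proj N t p.1) := by
    rw [← hμ, Measure.map_map (measurable_proj N t) measurable_fst]; rfl
  have hac : ρ ≪ μ.map (proj N t) := by
    rw [hμt, hρ]
    exact (Measure.absolutelyContinuous_of_le Measure.restrict_le_self).map hpf
  set g := ρ.rnDeriv (μ.map (proj N t)) with hg
  have hgm : Measurable g := Measure.measurable_rnDeriv _ _
  have hwd : (μ.map (proj N t)).withDensity g = ρ := Measure.withDensity_rnDeriv_eq _ _ hac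
  have key : ∀ s, t ≤ s → s ≤ N → ∀ φ : (Fin s → ℝ) → ℝ≥0∞, Measurable φ →
      ∫⁻ p, φ (proj N s p.1) * B'.indicator 1 (proj N t p.2) ∂γ
        = ∫⁻ x, g (proj N t x) * φ (proj N s x) ∂μ := by
    intro s hts
    induction s, hts using Nat.le_induction with
    | base =>
      intro _ φ hφ
      have e1 : ∫⁻ v, φ v ∂ρ = ∫⁻ x, g (proj N t x) * φ (proj N t x) ∂μ := by
        rw [← hwd, lintegral_withDensity_eq_lintegral_mul _ hgm hφ,
          lintegral_map (hgm.mul hφ) (measurable_proj N t)]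
        rfl
      rw [← e1, hρ, lintegral_map hφ hpf, ← lintegral_indicator hBp]
      refine lintegral_congr fun p => ?_
      by_cases b : proj N t p.2 ∈ B' <;> simp [b, Set.indicator]
    | succ s hts ih =>
      intro hsN φ hφ
      have hst := hs s (ht.trans hts) (by omega)
      have hst' := ae_of_ae_map (measurable_pairProj N s).aemeasurable hst
      have hre := measurable_restr hts
      have hsn := measurable_snocFun s
      have hΨ : Measurable (fun q : (Fin s → ℝ) × ℝ => φ (snocFun s q.1 q.2)) := hφ.comp hsn
      have hΦ : Measurable (fun v => ∫⁻ r, φ (snocFun s v r) ∂(nextK N μ s v)) :=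
        hΨ.lintegral_kernel_prod_right'
      have hΨ1 : ∀ v, Measurable (fun r : ℝ => φ (snocFun s v r)) := fun v =>
        hΨ.comp measurable_prodMk_left
      have e1 := lintegral_stepK N γ s
        (ψ := fun q => φ (snocFun s q.1.1 q.2) * B'.indicator 1 (restr hts q.1.2))
        ((hΨ.comp (by fun_prop : Measurable
            (fun q : ((Fin s → ℝ) × (Fin s → ℝ)) × ℝ => (q.1.1, q.2)))).mul (by fun_prop))
      have e2 := lintegral_nextK N μ s
        (ψ := fun q => g (restr hts q.1) * φ (snocFun s q.1 q.2)) (by fun_prop)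
      simp only [pairProj, restr_proj] at e1 e2
      simp only [proj_succ]
      rw [e1, e2]
      have e3 := ih (by omega) _ hΦ
      calc _ = ∫⁻ p, (∫⁻ r, φ (snocFun s (proj N s p.1) r) ∂(nextK N μ s (proj N s p.1)))
              * B'.indicator 1 (proj N t p.2) ∂γ := by
            refine lintegral_congr_ae ?_
            filter_upwards [hst'] with p hp
            simp only [pairProj] at hp
            rw [hp, lintegral_mul_const _ (hΨ1 _)]
        _ = _ := e3
        _ = _ := by
            refine lintegral_congr fun x => ?_
            rw [lintegral_const_mul _ (hΨ1 _)]
  refine ⟨g ∘ proj N t, hgm.comp (comap_measurable _), ?_⟩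
  refine ae_eq_of_forall_setLIntegral_eq_of_sigmaFinite (Kernel.measurable_coe K hBm)
    (hgm.comp (measurable_proj N t)) fun A hA _ => ?_
  have hAi : Measurable (A.indicator (1 : Path N → ℝ≥0∞)) := measurable_one.indicator hA
  have k := key N htN le_rfl (A.indicator 1) hAi
  simp only [proj_self] at k
  have d := lintegral_disint μ K hBm (F := A.indicator 1) hAi
  rw [hK] at d
  rw [← lintegral_indicator hA, ← lintegral_indicator hA]
  calc _ = ∫⁻ x, A.indicator 1 x * K x (proj N t ⁻¹' B') ∂μ := by
        refine lintegral_congr fun x => ?_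
        by_cases a : x ∈ A <;> simp [a, Set.indicator]
    _ = _ := d.symm
    _ = _ := k
    _ = _ := by
        refine lintegral_congr fun x => ?_
        by_cases a : x ∈ A <;> simp [a, Set.indicator]

theorem kernel_characterization_of_causality
    (N : ℕ) (hN : 0 < N)
    (μ ν : Measure (Path N)) [IsProbabilityMeasure μ] [IsProbabilityMeasure ν]
    (γ : Measure (Path N × Path N)) [IsProbabilityMeasure γ]
    (hγ : IsCoupling μ ν γ) :
    IsCausal N μ ν γ ↔
      (IsCoupling (μ.map (coord N 0)) (ν.map (coord N 0))
          (γ.map (fun p => (coord N 0 p.1, coord N 0 p.2)))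
        ∧ (∀ t : ℕ, 1 ≤ t → t < N →
            ∀ᵐ z ∂(γ.map (pairProj N t)),
              (stepK N γ t z).map Prod.fst = nextK N μ t z.1)
        ∧ (∀ t : ℕ, 1 ≤ t → t < N →
            ∀ᵐ ys ∂(ν.map (proj N t)),
              nextK N (γ.map Prod.snd) t ys = nextK N ν t ys)) := by
  have hm : Measurable (fun p : Path N × Path N => (coord N 0 p.1, coord N 0 p.2)) :=
    ((measurable_coord N 0).comp measurable_fst).prodMk
      ((measurable_coord N 0).comp measurable_snd)
  constructor
  · intro hc
    refine ⟨⟨?_, ?_⟩, fun t h1 h2 => causal_step N μ ν γ hc t h1 h2, ?_⟩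
    · rw [← hγ.1, Measure.map_map measurable_fst
        hm,
        Measure.map_map (measurable_coord N 0) measurable_fst]
      rfl
    · rw [← hγ.2, Measure.map_map measurable_snd
        hm,
        Measure.map_map (measurable_coord N 0) measurable_snd]
      rfl
    · intro t _ _
      obtain ⟨-, rfl⟩ := hγ
      exact ae_of_all _ fun _ => rfl
  · rintro ⟨-, h, -⟩
    exact step_causal N μ ν γ hγ h

end CausalTransport
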